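/- There exists a constant C > 0 such that the following holds for every positive integer N (with h = 1/N), every integer m with 1 ≤ m < N (with ε = m·h), and every continuous f : [0,1] → ℝ that vanishes on [0,ε], belongs to H¹(0,1) with derivative f', and whose derivative is absolutely continuous on [ε,1] with second derivative f'' ∈ L²(ε,1). Setting E_h(f) = (h/ε)·(∫₀¹ f'(x)² dx)^{1/2}·(∫_ε¹ f''(x)²·x² dx)^{1/2} + (h/ε)²·∫_ε¹ f''(x)²·x² dx, one has ∫₀¹ ((Π_h f)'(x))² dx ≤ ∫₀¹ f'(x)² dx + C·E_h(f) and ∫₀¹ x⁻²·(Π_h f)(x)² dx ≥ ∫₀¹ x⁻²·f(x)² dx − C·E_h(f). -/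

import Mathlib

open MeasureTheory Real Set Filter

noncomputable section

/-- `u ∈ H¹(0,1)` with weak derivative `u'`: `u` is continuous on `[0,1]`,
`u'` is (square-)integrable on `(0,1)`, and `u(x) = u(0) + ∫₀ˣ u'`. -/
def IsH1 (u u' : ℝ → ℝ) : Prop :=
  ContinuousOn u (Set.Icc 0 1) ∧
  IntervalIntegrable u' volume 0 1 ∧
  IntegrableOn (fun t => u' t ^ 2) (Set.Ioo 0 1) ∧
  ∀ x ∈ Set.Icc (0:ℝ) 1, u x = u 0 + ∫ t in (0:ℝ)..x, u' t

/-- The piecewise-linear interpolation operator `Π_h` on the uniform mesh with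
nodes `i/N`: on `[i/N, (i+1)/N)` it is the affine interpolant of the nodal values. -/
def interp (N : ℕ) (f : ℝ → ℝ) : ℝ → ℝ := fun x =>
  f ((⌊x * (N : ℝ)⌋ : ℝ) / (N : ℝ)) +
    (x - (⌊x * (N : ℝ)⌋ : ℝ) / (N : ℝ)) *
      ((f (((⌊x * (N : ℝ)⌋ : ℝ) + 1) / (N : ℝ)) - f ((⌊x * (N : ℝ)⌋ : ℝ) / (N : ℝ))) * (N : ℝ))

lemma aux_cs {g : ℝ → ℝ} {p q : ℝ} (hpq : p ≤ q) (hg : IntervalIntegrable g volume p q)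
    (hg2 : IntervalIntegrable (fun t => g t ^ 2) volume p q) :
    (∫ t in p..q, g t) ^ 2 ≤ (q - p) * ∫ t in p..q, g t ^ 2 := by
  rcases hpq.eq_or_lt with rfl | hlt
  · simp
  set I := ∫ t in p..q, g t with hI
  set J := ∫ t in p..q, g t ^ 2 with hJ
  have h0 : 0 ≤ ∫ t in p..q, ((q - p) * g t - I) ^ 2 :=
    intervalIntegral.integral_nonneg hpq (fun t _ => sq_nonneg _)
  have h1 : ∫ t in p..q, ((q - p) * g t - I) ^ 2
      = (q - p) ^ 2 * J - 2 * (q - p) * I * I + (q - p) * I ^ 2 := by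
    have e : (fun t => ((q - p) * g t - I) ^ 2)
        = fun t => ((q - p) ^ 2 * g t ^ 2 - (2 * (q - p) * I) * g t) + I ^ 2 := by
      funext t; ring
    rw [e, intervalIntegral.integral_add, intervalIntegral.integral_sub,
      intervalIntegral.integral_const_mul, intervalIntegral.integral_const_mul,
      intervalIntegral.integral_const, smul_eq_mul]
    · exact hg2.const_mul _
    · exact hg.const_mul _
    · exact (hg2.const_mul _).sub (hg.const_mul _)
    · exact intervalIntegrable_const
  have h2 : 0 ≤ (q - p) * ((q - p) * J - I ^ 2) := by
    rw [h1] at h0; linarith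
  have := nonneg_of_mul_nonneg_right h2 (by linarith)
  linarith

lemma aux_floor {N : ℕ} (hN : 0 < N) {i : ℕ} {x : ℝ} (h1 : (i : ℝ) / N ≤ x)
    (h2 : x < ((i : ℝ) + 1) / N) : ⌊x * (N : ℝ)⌋ = (i : ℤ) := by
  have hN' : (0 : ℝ) < N := by exact_mod_cast hN
  rw [Int.floor_eq_iff]
  rw [div_le_iff₀ hN'] at h1
  rw [lt_div_iff₀ hN'] at h2
  exact ⟨by exact_mod_cast h1, by exact_mod_cast h2⟩

lemma aux_interp {N : ℕ} (hN : 0 < N) (f : ℝ → ℝ) {i : ℕ} {x : ℝ} (h1 : (i : ℝ) / N ≤ x)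
    (h2 : x < ((i : ℝ) + 1) / N) :
    interp N f x = f ((i : ℝ) / N) +
      (x - (i : ℝ) / N) * ((f (((i : ℝ) + 1) / N) - f ((i : ℝ) / N)) * N) := by
  unfold interp
  rw [aux_floor hN h1 h2]
  simp

lemma aux_deriv {N : ℕ} (hN : 0 < N) (f : ℝ → ℝ) {i : ℕ} {x : ℝ} (h1 : (i : ℝ) / N < x)
    (h2 : x < ((i : ℝ) + 1) / N) :
    deriv (interp N f) x = (f (((i : ℝ) + 1) / N) - f ((i : ℝ) / N)) * N := by
  have : interp N f =ᶠ[nhds x] fun x => f ((i : ℝ) / N) +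
      (x - (i : ℝ) / N) * ((f (((i : ℝ) + 1) / N) - f ((i : ℝ) / N)) * N) := by
    filter_upwards [Ioo_mem_nhds h1 h2] with y hy
    exact aux_interp hN f hy.1.le hy.2
  rw [this.deriv_eq]
  have := ((((hasDerivAt_id x).sub_const ((i : ℝ) / N)).mul_const
    ((f (((i : ℝ) + 1) / N) - f ((i : ℝ) / N)) * N)).const_add (f ((i : ℝ) / N))).deriv
  simpa using this

lemma aux_meas (N : ℕ) (f : ℝ → ℝ) : Measurable (interp N f) := by
  have hfl : Measurable (fun x : ℝ => ⌊x * (N : ℝ)⌋) :=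
    Int.measurable_floor.comp (measurable_id.mul_const _)
  have ha : Measurable (fun x : ℝ => (⌊x * (N : ℝ)⌋ : ℝ) / (N : ℝ)) :=
    (measurable_from_top (f := fun k : ℤ => (k : ℝ) / (N : ℝ))).comp hfl
  have hb : Measurable (fun x : ℝ => f ((⌊x * (N : ℝ)⌋ : ℝ) / (N : ℝ))) :=
    (measurable_from_top (f := fun k : ℤ => f ((k : ℝ) / (N : ℝ)))).comp hfl
  have hc : Measurable (fun x : ℝ => f (((⌊x * (N : ℝ)⌋ : ℝ) + 1) / (N : ℝ))) :=
    (measurable_from_top (f := fun k : ℤ => f (((k : ℝ) + 1) / (N : ℝ)))).comp hfl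
  unfold interp
  exact hb.add ((measurable_id.sub ha).mul ((hc.sub hb).mul_const _))

lemma aux_first {N : ℕ} (hN : 0 < N) {f f' : ℝ → ℝ} (hf : IsH1 f f')
    (hI2 : IntervalIntegrable (fun t => f' t ^ 2) volume 0 1) :
    (∫ x in (0:ℝ)..1, (deriv (interp N f) x) ^ 2) ≤ ∫ x in (0:ℝ)..1, (f' x) ^ 2 := by
  have hN' : (0 : ℝ) < N := by exact_mod_cast hN
  obtain ⟨hc, hI, -, hF⟩ := hf
  set a : ℕ → ℝ := fun i => (i : ℝ) / N with ha
  have ha1 : ∀ i, a (i + 1) = ((i : ℝ) + 1) / N := by intro i; simp [ha]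
  have hd : ∀ i, a (i + 1) - a i = 1 / N := by intro i; rw [ha1]; simp only [ha]; ring
  have hle : ∀ i, a i ≤ a (i + 1) := by
    intro i; have := hd i; have : (0:ℝ) < 1 / N := by positivity
    linarith
  have hmem : ∀ i, i ≤ N → a i ∈ Set.Icc (0:ℝ) 1 := by
    intro i hi
    refine ⟨by simp only [ha]; positivity, ?_⟩
    simp only [ha]; rw [div_le_one hN']; exact_mod_cast hi
  have hsub : ∀ g : ℝ → ℝ, IntervalIntegrable g volume 0 1 → ∀ i < N,
      IntervalIntegrable g volume (a i) (a (i+1)) := by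
    intro g hg i hi
    apply hg.mono_set
    rw [Set.uIcc_of_le (hle i), Set.uIcc_of_le zero_le_one]
    exact Set.Icc_subset_Icc (hmem i hi.le).1 (hmem (i+1) hi).2
  have h0 : a 0 = 0 := by simp [ha]
  have h1 : a N = 1 := by simp [ha, hN'.ne']
  have hcong : ∀ i, Set.EqOn (fun x => (deriv (interp N f) x) ^ 2)
      (fun _ => ((f (a (i+1)) - f (a i)) * N) ^ 2) (Set.Ioo (a i) (a (i+1))) := by
    intro i x hx
    rw [ha1] at hx
    simp only
    rw [aux_deriv hN f hx.1 hx.2, ha1]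
  have hint : ∀ i, IntervalIntegrable (fun x => (deriv (interp N f) x) ^ 2) volume
      (a i) (a (i+1)) := by
    intro i
    rw [intervalIntegrable_iff_integrableOn_Ioo_of_le (hle i)]
    exact (integrableOn_congr_fun (hcong i) measurableSet_Ioo).2 (integrableOn_const (by simp))
  have hval : ∀ i, ∫ x in (a i)..(a (i+1)), (deriv (interp N f) x) ^ 2
      = (f (a (i+1)) - f (a i)) ^ 2 * N := by
    intro i
    rw [intervalIntegral.integral_congr_Ioo_of_le (hle i) (hcong i),
      intervalIntegral.integral_const, hd, smul_eq_mul]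
    field_simp
  have e1 := intervalIntegral.sum_integral_adjacent_intervals (μ := volume) (a := a) (n := N)
    (fun i _ => hint i)
  have e2 := intervalIntegral.sum_integral_adjacent_intervals (μ := volume) (a := a) (n := N)
    (fun i hi => hsub _ hI2 i hi)
  rw [h0, h1] at e1 e2
  rw [← e1, ← e2]
  apply Finset.sum_le_sum
  intro i hi
  rw [Finset.mem_range] at hi
  rw [hval]
  have hdiff : f (a (i+1)) - f (a i) = ∫ t in (a i)..(a (i+1)), f' t := by
    have z : IntervalIntegrable f' volume 0 (a i) := by
      apply hI.mono_set
      rw [Set.uIcc_of_le (hmem i hi.le).1, Set.uIcc_of_le zero_le_one]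
      exact Set.Icc_subset_Icc le_rfl (hmem i hi.le).2
    have := intervalIntegral.integral_add_adjacent_intervals z (hsub _ hI i hi)
    rw [hF _ (hmem (i+1) hi), hF _ (hmem i hi.le)]
    linarith
  have := aux_cs (hle i) (hsub _ hI i hi) (hsub _ hI2 i hi)
  rw [hd, ← hdiff] at this
  calc _ ≤ (1 / (N:ℝ) * ∫ t in (a i)..(a (i+1)), f' t ^ 2) * N := by gcongr
    _ = _ := by field_simp

/-- Pointwise Taylor-type bound for the interpolation error. -/
lemma aux_err {N : ℕ} (hN : 0 < N) {m : ℕ} (hm : 1 ≤ m) {f f' f'' : ℝ → ℝ}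
    (hf : IsH1 f f')
    (hT : ∀ x ∈ Set.Icc ((m:ℝ)/N) 1, f' x = f' ((m:ℝ)/N) + ∫ t in ((m:ℝ)/N)..x, f'' t)
    (hI : IntervalIntegrable f'' volume ((m:ℝ)/N) 1)
    (hI2 : IntervalIntegrable (fun t => f'' t ^ 2) volume ((m:ℝ)/N) 1)
    (hI3 : IntervalIntegrable (fun t => f'' t ^ 2 * t ^ 2) volume ((m:ℝ)/N) 1)
    {x : ℝ} (hx : x ∈ Set.Ioo ((m:ℝ)/N) 1) :
    |f x - interp N f x| * x ≤
      4 * (1/N) * Real.sqrt (1/N) * Real.sqrt (∫ t in ((m:ℝ)/N)..1, f'' t ^ 2 * t ^ 2) := by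
  have hN' : (0 : ℝ) < N := by exact_mod_cast hN
  have hm' : (1 : ℝ) ≤ m := by exact_mod_cast hm
  obtain ⟨hc, hF1, -, hF⟩ := hf
  set ε := (m:ℝ)/N with hε
  have hε0 : 0 < ε := by positivity
  set B := ∫ t in ε..1, f'' t ^ 2 * t ^ 2 with hB
  have hx0 : 0 < x := hε0.trans hx.1
  obtain ⟨i, hi⟩ : ∃ i : ℕ, i = ⌊x * N⌋₊ := ⟨_, rfl⟩
  have hi1 : (i:ℝ) ≤ x * N := by rw [hi]; exact Nat.floor_le (by positivity)
  have hi2 : x * N < i + 1 := by rw [hi]; exact Nat.lt_floor_add_one _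
  have him : m ≤ i := by
    rw [hi]; apply Nat.le_floor
    have := hx.1.le
    rw [hε, div_le_iff₀ hN'] at this; exact this
  have hiN : i + 1 ≤ N := by
    have : (i:ℝ) < N := by nlinarith [hx.2]
    exact_mod_cast this
  have him' : (m:ℝ) ≤ i := by exact_mod_cast him
  have hiN' : (i:ℝ) + 1 ≤ N := by exact_mod_cast hiN
  have hax : (i:ℝ)/N ≤ x := by rw [div_le_iff₀ hN']; exact hi1
  have hxb : x < ((i:ℝ)+1)/N := by rw [lt_div_iff₀ hN']; exact hi2
  rw [aux_interp hN f hax hxb]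
  set a := (i:ℝ)/N with ha
  set b := ((i:ℝ)+1)/N with hb
  set h := 1/(N:ℝ) with hh
  have hh0 : 0 < h := by positivity
  have hba : b = a + h := by rw [ha, hb, hh]; ring
  have hεa : ε ≤ a := by rw [hε, ha]; gcongr
  have hb1 : b ≤ 1 := by rw [hb, div_le_one hN']; exact hiN'
  have hha : h ≤ a := by rw [hh, ha]; gcongr; linarith
  have ha0 : 0 < a := by linarith
  have hsub : ∀ g : ℝ → ℝ, IntervalIntegrable g volume ε 1 → ∀ p q, ε ≤ p → p ≤ q → q ≤ 1 →
      IntervalIntegrable g volume p q := by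
    intro g hg p q h1 h2 h3
    apply hg.mono_set
    rw [Set.uIcc_of_le h2, Set.uIcc_of_le (by linarith)]
    exact Set.Icc_subset_Icc h1 h3
  -- derivative oscillation on the cell
  set K := Real.sqrt h * Real.sqrt B / a with hK
  have hB0 : 0 ≤ B := intervalIntegral.integral_nonneg (by linarith) (fun t _ => by positivity)
  have hK0 : 0 ≤ K := by positivity
  have hosc : ∀ t ∈ Set.Icc a b, |f' t - f' a| ≤ K := by
    intro t ht
    have e : f' t - f' a = ∫ r in a..t, f'' r := by
      have := intervalIntegral.integral_add_adjacent_intervals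
        (hsub _ hI ε a le_rfl hεa (by linarith)) (hsub _ hI a t hεa ht.1 (by linarith [ht.2]))
      rw [hT t ⟨by linarith [ht.1], by linarith [ht.2]⟩, hT a ⟨hεa, by linarith⟩]
      linarith
    have c := aux_cs ht.1 (hsub _ hI a t hεa ht.1 (by linarith [ht.2]))
      (hsub _ hI2 a t hεa ht.1 (by linarith [ht.2]))
    have d : a ^ 2 * ∫ r in a..t, f'' r ^ 2 ≤ B := by
      rw [← intervalIntegral.integral_const_mul]
      calc _ ≤ ∫ r in a..t, f'' r ^ 2 * r ^ 2 := by
            apply intervalIntegral.integral_mono_on ht.1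
              ((hsub _ hI2 a t hεa ht.1 (by linarith [ht.2])).const_mul _)
              (hsub _ hI3 a t hεa ht.1 (by linarith [ht.2]))
            intro r hr
            rw [mul_comm]
            have := hr.1
            gcongr
        _ ≤ B := by
            apply intervalIntegral.integral_mono_interval hεa ht.1 (by linarith [ht.2]) _ hI3
            exact Eventually.of_forall (fun r => by simp only [Pi.zero_apply]; positivity)
    have nn : 0 ≤ ∫ r in a..t, f'' r ^ 2 :=
      intervalIntegral.integral_nonneg ht.1 (fun t _ => by positivity)
    apply abs_le_of_sq_le_sq _ hK0
    rw [e, hK, div_pow, mul_pow, Real.sq_sqrt hh0.le, Real.sq_sqrt hB0, le_div_iff₀ (by positivity)]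
    calc _ ≤ ((t - a) * ∫ r in a..t, f'' r ^ 2) * a ^ 2 := by gcongr
      _ ≤ (h * ∫ r in a..t, f'' r ^ 2) * a ^ 2 := by gcongr; linarith [ht.2]
      _ = h * (a ^ 2 * ∫ r in a..t, f'' r ^ 2) := by ring
      _ ≤ _ := by gcongr
  have htay : ∀ y ∈ Set.Icc a b, |f y - f a - (y - a) * f' a| ≤ K * (y - a) := by
    intro y hy
    have z : ∀ p q, 0 ≤ p → p ≤ q → q ≤ 1 → IntervalIntegrable f' volume p q := by
      intro p q h1 h2 h3
      apply hF1.mono_set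
      rw [Set.uIcc_of_le h2, Set.uIcc_of_le zero_le_one]
      exact Set.Icc_subset_Icc h1 h3
    have e : f y - f a - (y - a) * f' a = ∫ t in a..y, (f' t - f' a) := by
      have := intervalIntegral.integral_add_adjacent_intervals
        (z 0 a le_rfl ha0.le (by linarith)) (z a y ha0.le hy.1 (by linarith [hy.2]))
      rw [intervalIntegral.integral_sub (z a y ha0.le hy.1 (by linarith [hy.2]))
        intervalIntegrable_const, intervalIntegral.integral_const, smul_eq_mul,
        hF y ⟨by linarith [hy.1], by linarith [hy.2]⟩, hF a ⟨ha0.le, by linarith⟩]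
      linarith
    rw [e]
    have := intervalIntegral.norm_integral_le_of_norm_le_const (a := a) (b := y) (C := K)
      (f := fun t => f' t - f' a) (by
        intro t ht
        rw [Set.uIoc_of_le hy.1] at ht
        exact hosc t ⟨ht.1.le, ht.2.trans hy.2⟩)
    rwa [abs_of_nonneg (by linarith [hy.1] : 0 ≤ y - a)] at this
  have t1 := htay x ⟨hax, hxb.le⟩
  have t2 := htay b ⟨by linarith, le_rfl⟩
  have hbma : b - a = h := by linarith
  rw [hbma] at t2
  have hNh : (N:ℝ) = 1/h := by rw [hh]; simp
  have t3 : |(f b - f a) * N - f' a| ≤ K := by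
    have : (f b - f a) * N - f' a = (f b - f a - h * f' a) / h := by
      rw [hNh]; field_simp
    rw [this, abs_div, abs_of_pos hh0, div_le_iff₀ hh0]; exact t2
  have hxa : 0 ≤ x - a := by linarith
  have t4 : |f x - (f a + (x - a) * ((f b - f a) * N))| ≤ 2 * K * h := by
    have e : f x - (f a + (x - a) * ((f b - f a) * N))
      = (f x - f a - (x - a) * f' a) - (x - a) * ((f b - f a) * N - f' a) := by ring
    rw [e]
    calc _ ≤ |f x - f a - (x - a) * f' a| + |(x - a) * ((f b - f a) * N - f' a)| := abs_sub _ _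
      _ ≤ K * (x - a) + (x - a) * K := by
          rw [abs_mul, abs_of_nonneg hxa]; gcongr
      _ ≤ _ := by nlinarith
  have hx2a : x ≤ 2 * a := by linarith
  calc _ ≤ (2 * K * h) * (2 * a) := by gcongr
    _ = _ := by rw [hK]; field_simp; ring

/-- Interpolation estimates: there is `C > 0` such that for every mesh size `h = 1/N`,
every interpolation node `ε = m·h` with `1 ≤ m < N`, and every `f ∈ H¹(0,1)` vanishing
on `[0,ε]` whose derivative is absolutely continuous on `[ε,1]` with `f'' ∈ L²(ε,1)`,
setting `E_h(f) = (h/ε)·(∫₀¹ f'²)^½·(∫_ε¹ f''²x²)^½ + (h/ε)²·∫_ε¹ f''²x²`, one has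
`∫₀¹ ((Π_h f)')² ≤ ∫₀¹ f'² + C·E_h(f)` and `∫₀¹ (Π_h f)²/x² ≥ ∫₀¹ f²/x² − C·E_h(f)`. -/
theorem interp_estimates :
    ∃ C : ℝ, 0 < C ∧ ∀ N : ℕ, 0 < N → ∀ m : ℕ, 1 ≤ m → m < N →
      ∀ h ε : ℝ, h = 1 / (N : ℝ) → ε = (m : ℝ) * h →
      ∀ f f' f'' : ℝ → ℝ,
        IsH1 f f' →
        (∀ x ∈ Set.Icc (0:ℝ) ε, f x = 0) →
        (∀ x ∈ Set.Icc ε 1, f' x = f' ε + ∫ t in ε..x, f'' t) →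
        IntervalIntegrable f'' volume ε 1 →
        IntegrableOn (fun t => f'' t ^ 2) (Set.Ioo ε 1) →
        ∀ E : ℝ,
          E = (h / ε) * Real.sqrt (∫ x in (0:ℝ)..1, (f' x) ^ 2)
                * Real.sqrt (∫ x in ε..1, (f'' x) ^ 2 * x ^ 2)
              + (h / ε) ^ 2 * ∫ x in ε..1, (f'' x) ^ 2 * x ^ 2 →
          (∫ x in (0:ℝ)..1, (deriv (interp N f) x) ^ 2)
              ≤ (∫ x in (0:ℝ)..1, (f' x) ^ 2) + C * E ∧
          (∫ x in (0:ℝ)..1, (interp N f x) ^ 2 / x ^ 2)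
              ≥ (∫ x in (0:ℝ)..1, (f x) ^ 2 / x ^ 2) - C * E := by
  refine ⟨8, by norm_num, ?_⟩
  intro N hN m hm hmN h ε hh hε f f' f'' hf hz hT hI hI2o E hE
  have hN' : (0 : ℝ) < N := by exact_mod_cast hN
  have hm' : (1 : ℝ) ≤ m := by exact_mod_cast hm
  have hmN' : (m : ℝ) < N := by exact_mod_cast hmN
  have hh0 : 0 < h := by rw [hh]; positivity
  have hε' : ε = (m : ℝ) / N := by rw [hε, hh]; ring
  have hε0 : 0 < ε := by rw [hε']; positivity
  have hε1 : ε < 1 := by rw [hε', div_lt_one hN']; exact hmN'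
  have hhε : h ≤ ε := by rw [hε]; nlinarith
  have hA2 : IntervalIntegrable (fun t => f' t ^ 2) volume 0 1 :=
    (intervalIntegrable_iff_integrableOn_Ioo_of_le zero_le_one).2 hf.2.2.1
  have hI2 : IntervalIntegrable (fun t => f'' t ^ 2) volume ε 1 :=
    (intervalIntegrable_iff_integrableOn_Ioo_of_le hε1.le).2 hI2o
  have hI3 : IntervalIntegrable (fun t => f'' t ^ 2 * t ^ 2) volume ε 1 :=
    hI2.mul_continuousOn (by fun_prop)
  set A := ∫ x in (0:ℝ)..1, (f' x) ^ 2 with hA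
  set B := ∫ x in ε..1, (f'' x) ^ 2 * x ^ 2 with hB
  have hA0 : 0 ≤ A := intervalIntegral.integral_nonneg zero_le_one (fun t _ => by positivity)
  have hB0 : 0 ≤ B := intervalIntegral.integral_nonneg hε1.le (fun t _ => by positivity)
  have hE1 : h / ε * Real.sqrt A * Real.sqrt B ≤ E := by
    rw [hE]
    have : 0 ≤ (h / ε) ^ 2 * B := by positivity
    linarith
  have hE0 : 0 ≤ E := le_trans (by positivity) hE1
  refine ⟨?_, ?_⟩
  · have := aux_first hN hf hA2
    linarith
  have hfb : ∀ x ∈ Set.Icc (0:ℝ) 1, |f x| ≤ Real.sqrt x * Real.sqrt A := by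
    intro x hx
    apply abs_le_of_sq_le_sq _ (by positivity)
    rw [mul_pow, Real.sq_sqrt hx.1, Real.sq_sqrt hA0]
    rw [hf.2.2.2 x hx, hz 0 ⟨le_rfl, hε0.le⟩, zero_add]
    have s : Set.uIcc 0 x ⊆ Set.uIcc (0:ℝ) 1 := by
      rw [Set.uIcc_of_le hx.1, Set.uIcc_of_le zero_le_one]
      exact Set.Icc_subset_Icc le_rfl hx.2
    have c := aux_cs hx.1 (hf.2.1.mono_set s) (hA2.mono_set s)
    rw [sub_zero] at c
    have : ∫ t in (0:ℝ)..x, f' t ^ 2 ≤ A :=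
      intervalIntegral.integral_mono_interval le_rfl hx.1 hx.2
        (Eventually.of_forall (fun r => by simp only [Pi.zero_apply]; positivity)) hA2
    exact c.trans (mul_le_mul_of_nonneg_left this hx.1)
  have herr : ∀ x ∈ Set.Ioo ε 1, |f x - interp N f x| * x
      ≤ 4 * h * Real.sqrt h * Real.sqrt B := by
    intro x hx
    have := aux_err (x := x) hN hm hf (f'' := f'') (by rw [← hε']; exact hT)
      (by rw [← hε']; exact hI) (by rw [← hε']; exact hI2) (by rw [← hε']; exact hI3)
      (by rw [← hε']; exact hx)
    rwa [← hε', ← hh] at this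
  -- integrability
  have hfx1 : ∀ x ∈ Set.Ioo ε 1, |f x| ≤ Real.sqrt A := by
    intro x hx
    refine (hfb x ⟨by linarith [hx.1], hx.2.le⟩).trans ?_
    have : Real.sqrt x ≤ 1 := Real.sqrt_le_one.2 hx.2.le
    nlinarith [Real.sqrt_nonneg A]
  have hbd : ∀ (g : ℝ → ℝ) (M : ℝ), 0 ≤ M → AEStronglyMeasurable g (volume.restrict (Set.Ioo ε 1)) →
      (∀ x ∈ Set.Ioo ε 1, |g x| ≤ M) →
      IntervalIntegrable (fun x => g x ^ 2 / x ^ 2) volume ε 1 := by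
    intro g M hM hg hgM
    rw [intervalIntegrable_iff_integrableOn_Ioo_of_le hε1.le]
    refine Integrable.of_bound (C := M ^ 2 / ε ^ 2) ?_ ?_
    · have hid : AEStronglyMeasurable (fun x : ℝ => (x ^ 2)⁻¹) (volume.restrict (Set.Ioo ε 1)) :=
        (by fun_prop : Measurable (fun x : ℝ => (x ^ 2)⁻¹)).aestronglyMeasurable
      simp only [div_eq_mul_inv]
      exact (hg.pow 2).mul hid
    · rw [ae_restrict_iff' measurableSet_Ioo]
      refine Eventually.of_forall (fun x hx => ?_)
      rw [Real.norm_eq_abs, abs_of_nonneg (by positivity)]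
      have h1 := hgM x hx
      have h2 : g x ^ 2 ≤ M ^ 2 := by rw [← sq_abs (g x)]; gcongr
      have h3 := hx.1.le
      gcongr
  have if1 : IntervalIntegrable (fun x => f x ^ 2 / x ^ 2) volume ε 1 := by
    refine hbd f _ (Real.sqrt_nonneg A) ?_ hfx1
    refine (hf.1.mono ?_).aestronglyMeasurable measurableSet_Ioo
    intro x hx
    exact ⟨by linarith [hx.1], hx.2.le⟩
  have if2 : IntervalIntegrable (fun x => interp N f x ^ 2 / x ^ 2) volume ε 1 := by
    refine hbd _ (Real.sqrt A + 4 * h * Real.sqrt h * Real.sqrt B / ε) (by positivity)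
      (aux_meas N f).aestronglyMeasurable ?_
    intro x hx
    have h1 := hfx1 x hx
    have h2 : |f x - interp N f x| ≤ 4 * h * Real.sqrt h * Real.sqrt B / ε := by
      rw [le_div_iff₀ hε0]
      exact (mul_le_mul_of_nonneg_left hx.1.le (abs_nonneg _)).trans (herr x hx)
    have h3 : |interp N f x| ≤ |f x| + |f x - interp N f x| := by
      have := abs_sub (f x) (f x - interp N f x)
      rwa [sub_sub_cancel] at this
    linarith
  -- both integrands vanish on (0, ε)
  have z1 : Set.EqOn (fun x => f x ^ 2 / x ^ 2) (fun _ => (0:ℝ)) (Set.Ioo 0 ε) := by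
    intro x hx
    simp [hz x ⟨hx.1.le, hx.2.le⟩]
  have z2 : Set.EqOn (fun x => interp N f x ^ 2 / x ^ 2) (fun _ => (0:ℝ)) (Set.Ioo 0 ε) := by
    intro x hx
    have hx0 := hx.1
    have k1 : ((⌊x * N⌋₊ : ℕ) : ℝ) ≤ x * N := Nat.floor_le (by positivity)
    have k2 : x * N < (⌊x * N⌋₊ : ℕ) + 1 := Nat.lt_floor_add_one _
    have k3 : ⌊x * N⌋₊ < m := by
      have : x * N < m := by
        have := hx.2
        rw [hε', lt_div_iff₀ hN'] at this
        exact this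
      have : ((⌊x * N⌋₊ : ℕ) : ℝ) < m := by linarith
      exact_mod_cast this
    have k4 : ((⌊x * N⌋₊ : ℕ) : ℝ) + 1 ≤ m := by exact_mod_cast k3
    generalize ⌊x * N⌋₊ = i at *
    have e1 : f ((i : ℝ) / N) = 0 :=
      hz _ ⟨by positivity, by rw [hε']; gcongr⟩
    have e2 : f (((i : ℝ) + 1) / N) = 0 :=
      hz _ ⟨by positivity, by rw [hε']; gcongr⟩
    simp only
    rw [aux_interp hN f (i := i) (by rw [div_le_iff₀ hN']; exact k1)
      (by rw [lt_div_iff₀ hN']; exact k2), e1, e2]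
    simp
  have hzint : ∀ g : ℝ → ℝ, Set.EqOn g (fun _ => (0:ℝ)) (Set.Ioo 0 ε) →
      IntervalIntegrable g volume ε 1 → ∫ x in (0:ℝ)..1, g x = ∫ x in ε..1, g x := by
    intro g hg hgi
    have i0 : IntervalIntegrable g volume 0 ε := by
      rw [intervalIntegrable_iff_integrableOn_Ioo_of_le hε0.le]
      exact (integrableOn_congr_fun hg measurableSet_Ioo).2 integrableOn_zero
    rw [← intervalIntegral.integral_add_adjacent_intervals i0 hgi,
      intervalIntegral.integral_congr_Ioo_of_le hε0.le hg]
    simp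
  rw [hzint _ z1 if1, hzint _ z2 if2]
  set D := 8 * h * Real.sqrt A * Real.sqrt B with hD
  have hD0 : 0 ≤ D := by positivity
  have hpt : ∀ x ∈ Set.Ioo ε 1, f x ^ 2 / x ^ 2 - interp N f x ^ 2 / x ^ 2 ≤ D * x ^ (-2 : ℤ) := by
    intro x hx
    have hx0 : 0 < x := hε0.trans hx.1
    have hhx : Real.sqrt h ≤ Real.sqrt x := Real.sqrt_le_sqrt (by linarith [hx.1])
    have q1 := hfb x ⟨hx0.le, hx.2.le⟩
    have q2 := herr x hx
    have q3 : |f x| * |f x - interp N f x| ≤ 4 * h * Real.sqrt A * Real.sqrt B := by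
      have : |f x| * |f x - interp N f x| * x ≤ 4 * h * Real.sqrt A * Real.sqrt B * x := by
        calc _ = |f x| * (|f x - interp N f x| * x) := by ring
          _ ≤ (Real.sqrt x * Real.sqrt A) * (4 * h * Real.sqrt h * Real.sqrt B) := by gcongr
          _ ≤ (Real.sqrt x * Real.sqrt A) * (4 * h * Real.sqrt x * Real.sqrt B) := by gcongr
          _ = 4 * h * Real.sqrt A * Real.sqrt B * (Real.sqrt x * Real.sqrt x) := by ring
          _ = _ := by rw [Real.mul_self_sqrt hx0.le]
      exact le_of_mul_le_mul_right this hx0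
    have q4 : f x * (f x - interp N f x) ≤ |f x| * |f x - interp N f x| := by
      rw [← abs_mul]; exact le_abs_self _
    have q5 : f x ^ 2 - interp N f x ^ 2 ≤ D := by
      nlinarith [sq_nonneg (f x - interp N f x)]
    rw [← sub_div, zpow_neg, ← div_eq_mul_inv]
    exact div_le_div_of_nonneg_right q5 (by positivity)
  have h0n : (0:ℝ) ∉ Set.uIcc ε 1 := by
    rw [Set.uIcc_of_le hε1.le]
    intro hc
    linarith [hc.1]
  have hint : ∫ x in ε..1, x ^ (-2 : ℤ) = 1 / ε - 1 := by
    rw [integral_zpow (Or.inr ⟨by norm_num, h0n⟩)]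
    norm_num
    ring
  have hii : IntervalIntegrable (fun x : ℝ => D * x ^ (-2 : ℤ)) volume ε 1 :=
    (intervalIntegral.intervalIntegrable_zpow (Or.inr h0n)).const_mul _
  have hmono := intervalIntegral.integral_mono_on_of_le_Ioo hε1.le (if1.sub if2) hii hpt
  rw [intervalIntegral.integral_sub if1 if2, intervalIntegral.integral_const_mul, hint] at hmono
  have hfin : D * (1 / ε - 1) ≤ 8 * E := by
    calc D * (1 / ε - 1) ≤ D * (1 / ε) := by gcongr; linarith
      _ = 8 * (h / ε * Real.sqrt A * Real.sqrt B) := by rw [hD]; ring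
      _ ≤ 8 * E := by gcongr
  linarith
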